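/- Fix ρ > 0 and a countable collection of languages 𝓛 : ℕ → Set ℕ (each 𝓛 i infinite). The following are equivalent: (i) there exists a set-based generator G : List ℕ → Set ℕ such that for every index i and every enumeration x of K := 𝓛 i with finite noise and finite omissions, G generates in the limit from K under x and liminf_{n→∞} μ_low(G(x_1,…,x_n), K) ≥ ρ; (ii) for all languages L, L' in {𝓛 i : i ∈ ℕ} with |L \ L'| < ∞, one has μ_low(L, L') ≥ ρ. -/

import Mathlib

open Filter Set Topology

/-- The list `[x 0, …, x (n-1)]` of the first `n` elements of the stream `x`
(the paper's `x_1, …, x_n`). -/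
def prefixList (x : ℕ → ℕ) (n : ℕ) : List ℕ := (List.range n).map x

/-- The set of the first `n` elements of the stream `x` (the paper's `{x_1, …, x_n}`). -/
def seen (x : ℕ → ℕ) (n : ℕ) : Set ℕ := x '' {t | t < n}

/-- The empirical noise rate `R(L; x_{1:n})` of the first `n` elements of `x` w.r.t. `L`. -/
noncomputable def noiseRate (L : Set ℕ) (x : ℕ → ℕ) (n : ℕ) : ℝ :=
  (({t | t < n ∧ x t ∉ L}).ncard : ℝ) / n

/-- `|A ∩ {b_1, …, b_m}| / m` where `b_1 < b_2 < …` is the increasing enumeration of `B`. -/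
noncomputable def densityRatio (A B : Set ℕ) (m : ℕ) : ℝ :=
  (({j | j < m ∧ Nat.nth (· ∈ B) j ∈ A}).ncard : ℝ) / m

/-- Lower density `μ_low(A, B)` of `A` in `B`. -/
noncomputable def lowDensity (A B : Set ℕ) : ℝ := Filter.liminf (densityRatio A B) Filter.atTop

/-- Upper density `μ_up(A, B)` of `A` in `B`. -/
noncomputable def upDensity (A B : Set ℕ) : ℝ := Filter.limsup (densityRatio A B) Filter.atTop

lemma densityRatio_nonneg (A B : Set ℕ) (m : ℕ) : 0 ≤ densityRatio A B m := by
  unfold densityRatio; positivity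

lemma densityRatio_le_one (A B : Set ℕ) (m : ℕ) : densityRatio A B m ≤ 1 := by
  unfold densityRatio
  refine div_le_one_of_le₀ ?_ (Nat.cast_nonneg m)
  have h : {j | j < m ∧ Nat.nth (· ∈ B) j ∈ A}.ncard ≤ (Set.Iio m).ncard :=
    Set.ncard_le_ncard (fun j hj => hj.1) (Set.finite_Iio m)
  simpa using h

lemma isBoundedUnder_ge_densityRatio (A B : Set ℕ) :
    IsBoundedUnder (· ≥ ·) atTop (densityRatio A B) :=
  isBoundedUnder_of ⟨0, densityRatio_nonneg A B⟩

lemma isCoboundedUnder_ge_densityRatio (A B : Set ℕ) :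
    IsCoboundedUnder (· ≥ ·) atTop (densityRatio A B) :=
  (isBoundedUnder_of ⟨1, densityRatio_le_one A B⟩ :
    IsBoundedUnder (· ≤ ·) atTop (densityRatio A B)).isCoboundedUnder_ge

lemma lowDensity_nonneg (A B : Set ℕ) : 0 ≤ lowDensity A B :=
  le_liminf_of_le (isCoboundedUnder_ge_densityRatio A B)
    (Eventually.of_forall (densityRatio_nonneg A B))

lemma lowDensity_le_one (A B : Set ℕ) : lowDensity A B ≤ 1 :=
  liminf_le_of_frequently_le (Frequently.of_forall (densityRatio_le_one A B))
    (isBoundedUnder_ge_densityRatio A B)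

/-- Up to a vanishing error, the density ratio is monotone with respect to inclusion modulo
finite sets. -/
lemma densityRatio_le_add {A A' B : Set ℕ} (hB : B.Infinite) (hA : (A \ A').Finite) (m : ℕ) :
    densityRatio A B m ≤ densityRatio A' B m + ((A \ A').ncard : ℝ) / m := by
  unfold densityRatio
  rw [← add_div]
  gcongr
  have hfin : ∀ D : Set ℕ, {j | j < m ∧ Nat.nth (· ∈ B) j ∈ D}.Finite := fun D =>
    (Set.finite_Iio m).subset fun j hj => hj.1
  have hsub : {j | j < m ∧ Nat.nth (· ∈ B) j ∈ A} ⊆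
      {j | j < m ∧ Nat.nth (· ∈ B) j ∈ A'} ∪ {j | j < m ∧ Nat.nth (· ∈ B) j ∈ A \ A'} := by
    rintro j ⟨hj, hjA⟩
    by_cases h : Nat.nth (· ∈ B) j ∈ A'
    · exact Or.inl ⟨hj, h⟩
    · exact Or.inr ⟨hj, hjA, h⟩
  have hcard : {j | j < m ∧ Nat.nth (· ∈ B) j ∈ A \ A'}.ncard ≤ (A \ A').ncard :=
    Set.ncard_le_ncard_of_injOn (Nat.nth (· ∈ B)) (fun j hj => hj.2)
      (Nat.nth_injective hB).injOn hA
  have h := (Set.ncard_le_ncard hsub ((hfin _).union (hfin _))).trans (Set.ncard_union_le _ _)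
  exact_mod_cast h.trans (Nat.add_le_add_left hcard _)

/-- Lower density is monotone with respect to inclusion modulo finite sets. -/
lemma lowDensity_le_of_diff_finite {A A' B : Set ℕ} (hB : B.Infinite) (hA : (A \ A').Finite) :
    lowDensity A B ≤ lowDensity A' B := by
  refine le_of_forall_lt fun b hb => ?_
  obtain ⟨a, hba, ha⟩ := exists_between hb
  obtain ⟨c, hbc, hca⟩ := exists_between hba
  refine hbc.trans_le (le_liminf_of_le (isCoboundedUnder_ge_densityRatio A' B) ?_)
  have hsmall : ∀ᶠ m : ℕ in atTop, ((A \ A').ncard : ℝ) / m < a - c :=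
    (tendsto_const_div_atTop_nhds_zero_nat _).eventually_lt_const (sub_pos.2 hca)
  filter_upwards [eventually_lt_of_lt_liminf ha (isBoundedUnder_ge_densityRatio A B), hsmall]
    with m h₁ h₂
  linarith [densityRatio_le_add hB hA m]

lemma mem_prefixList {x : ℕ → ℕ} {n a : ℕ} : a ∈ prefixList x n ↔ a ∈ seen x n := by
  simp [prefixList, seen]

lemma length_prefixList (x : ℕ → ℕ) (n : ℕ) : (prefixList x n).length = n := by
  simp [prefixList]

lemma nodup_prefixList {x : ℕ → ℕ} (hx : Function.Injective x) (n : ℕ) :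
    (prefixList x n).Nodup :=
  List.nodup_range.map hx

lemma seen_finite (x : ℕ → ℕ) (n : ℕ) : (seen x n).Finite :=
  (Set.finite_Iio n).image x

lemma seen_subset_range (x : ℕ → ℕ) (n : ℕ) : seen x n ⊆ Set.range x :=
  Set.image_subset_range _ _

/-- Every finite subset of the range of `x` is eventually seen. -/
lemma eventually_subset_seen {x : ℕ → ℕ} {T : Set ℕ} (hT : T.Finite) (h : T ⊆ Set.range x) :
    ∀ᶠ n in atTop, T ⊆ seen x n := by
  refine (eventually_all_finite hT).2 fun a ha => ?_
  obtain ⟨t, rfl⟩ := h ha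
  filter_upwards [eventually_gt_atTop t] with n hn
  exact ⟨t, hn, rfl⟩

/-- A list without duplicates is the beginning of an enumeration of its elements together with
any given infinite set. -/
lemma exists_enumeration_extending {l : List ℕ} (hl : l.Nodup) {L : Set ℕ} (hL : L.Infinite) :
    ∃ x : ℕ → ℕ, Function.Injective x ∧ prefixList x l.length = l ∧
      Set.range x = {a | a ∈ l} ∪ L := by
  have hM : (L \ {a | a ∈ l}).Infinite := hL.sdiff l.finite_toSet
  set M : Set ℕ := L \ {a | a ∈ l}
  have hmem : ∀ t, Nat.nth (· ∈ M) t ∈ M := fun t => Nat.nth_mem_of_infinite hM t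
  let x : ℕ → ℕ := fun t => if h : t < l.length then l[t] else Nat.nth (· ∈ M) (t - l.length)
  have hlt : ∀ t (h : t < l.length), x t = l[t] := fun t h => dif_pos h
  have hge : ∀ t, ¬ t < l.length → x t = Nat.nth (· ∈ M) (t - l.length) := fun t h => dif_neg h
  refine ⟨x, ?_, ?_, ?_⟩
  · intro s t hst
    by_cases hs : s < l.length <;> by_cases ht : t < l.length
    · rw [hlt s hs, hlt t ht] at hst
      exact (hl.getElem_inj_iff).1 hst
    · rw [hlt s hs, hge t ht] at hst
      exact absurd (hst ▸ List.getElem_mem hs) (hmem (t - l.length)).2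
    · rw [hge s hs, hlt t ht] at hst
      exact absurd (hst ▸ List.getElem_mem ht) (hmem (s - l.length)).2
    · rw [hge s hs, hge t ht] at hst
      have := Nat.nth_injective hM hst
      omega
  · refine List.ext_getElem (length_prefixList _ _) fun t _ h₂ => ?_
    simp [prefixList, hlt t h₂]
  · ext a
    constructor
    · rintro ⟨t, rfl⟩
      by_cases ht : t < l.length
      · exact Or.inl (by rw [hlt t ht]; exact List.getElem_mem ht)
      · exact Or.inr (by rw [hge t ht]; exact (hmem _).1)
    · intro ha
      by_cases hal : a ∈ l
      · obtain ⟨t, ht, rfl⟩ := List.getElem_of_mem hal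
        exact ⟨t, hlt t ht⟩
      · have haM : a ∈ M := ⟨ha.resolve_left hal, hal⟩
        obtain ⟨t, ht⟩ : a ∈ Set.range (Nat.nth (· ∈ M)) :=
          (Nat.range_nth_of_infinite (p := (· ∈ M)) hM).symm ▸ haM
        refine ⟨t + l.length, ?_⟩
        rw [hge _ (by omega), Nat.add_sub_cancel, ht]

lemma prefixList_prefix (x : ℕ → ℕ) {m n : ℕ} (h : m ≤ n) :
    prefixList x m <+: prefixList x n := by
  obtain ⟨k, rfl⟩ := Nat.exists_eq_add_of_le h
  simp [prefixList, List.range_add]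

/-- A chain of strictly longer and longer lists without duplicates has a limit stream. -/
lemma exists_limit_of_prefix_chain {S : ℕ → List ℕ} (hnodup : ∀ k, (S k).Nodup)
    (hpre : ∀ k, S k <+: S (k + 1)) (hlen : ∀ k, (S k).length < (S (k + 1)).length) :
    ∃ x : ℕ → ℕ, Function.Injective x ∧ (∀ k, prefixList x (S k).length = S k) ∧
      Set.range x = {a | ∃ k, a ∈ S k} := by
  have hmono : ∀ {k m}, k ≤ m → S k <+: S m := fun {k m} h => by
    induction m, h using Nat.le_induction with
    | base => exact List.prefix_rfl
    | succ m _ ih => exact ih.trans (hpre m)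
  have hge : ∀ k, k ≤ (S k).length := (strictMono_nat_of_lt_succ hlen).id_le
  have hlt : ∀ t, t < (S (t + 1)).length := fun t => hge (t + 1)
  let x : ℕ → ℕ := fun t => (S (t + 1))[t]'(hlt t)
  have hx : ∀ k t (h : t < (S k).length), x t = (S k)[t] := by
    intro k t h
    rcases le_total k (t + 1) with hk | hk
    · exact ((hmono hk).getElem h).symm
    · exact (hmono hk).getElem (hlt t)
  refine ⟨x, ?_, ?_, ?_⟩
  · intro s t hst
    have hs : s < (S (max s t + 1)).length := by have := hge (max s t + 1); omega
    have ht : t < (S (max s t + 1)).length := by have := hge (max s t + 1); omega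
    rw [hx _ s hs, hx _ t ht] at hst
    exact (hnodup _).getElem_inj_iff.1 hst
  · intro k
    refine List.ext_getElem (length_prefixList _ _) fun t _ h₂ => ?_
    simp [prefixList, hx k t h₂]
  · ext a
    constructor
    · rintro ⟨t, rfl⟩
      exact ⟨t + 1, List.getElem_mem (hlt t)⟩
    · rintro ⟨k, hk⟩
      obtain ⟨t, ht, rfl⟩ := List.getElem_of_mem hk
      exact ⟨t, hx k t ht⟩

/-- If `G` is eventually inside `L` on all enumerations of `L` with finite noise, then some
enumeration of `L ∪ L'` makes the output of `G` a subset of `L` infinitely often. -/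
lemma exists_enumeration_frequently_subset {G : List ℕ → Set ℕ} {L : Set ℕ} (L' : Set ℕ)
    (hL : L.Infinite)
    (hG : ∀ x : ℕ → ℕ, Function.Injective x → (Set.range x \ L).Finite →
      (L \ Set.range x).Finite → ∀ᶠ n in atTop, G (prefixList x n) ⊆ L) :
    ∃ x : ℕ → ℕ, Function.Injective x ∧ Set.range x ⊆ L ∪ L' ∧ L' ⊆ Set.range x ∧
      ∃ᶠ n in atTop, G (prefixList x n) ⊆ L := by
  have hext : ∀ l : List ℕ, l.Nodup → ∃ l' : List ℕ, l'.Nodup ∧ l <+: l' ∧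
      l.length < l'.length ∧ (∀ a ∈ l', a ∈ l ∨ a ∈ L) ∧ G l' ⊆ L := by
    intro l hl
    obtain ⟨x, hx, hxl, hrange⟩ := exists_enumeration_extending hl hL
    have h₁ : (Set.range x \ L).Finite := by
      refine l.finite_toSet.subset fun a ha => ?_
      rw [hrange] at ha
      exact ha.1.resolve_right ha.2
    have h₂ : (L \ Set.range x).Finite := by
      rw [hrange, Set.sdiff_eq_empty.2 Set.subset_union_right]
      exact Set.finite_empty
    obtain ⟨n, hn, hGn⟩ := ((eventually_gt_atTop l.length).and (hG x hx h₁ h₂)).exists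
    refine ⟨prefixList x n, nodup_prefixList hx n, ?_, ?_, fun a ha => ?_, hGn⟩
    · nth_rewrite 1 [← hxl]
      exact prefixList_prefix x hn.le
    · rwa [length_prefixList]
    · have := seen_subset_range x n (mem_prefixList.1 ha)
      rwa [hrange] at this
  have hstep : ∀ (m : ℕ) (l : {l : List ℕ // l.Nodup}), ∃ l' : {l : List ℕ // l.Nodup},
      l.1 <+: l'.1 ∧ l.1.length < l'.1.length ∧ (m ∈ L' → m ∈ l'.1) ∧
      (∀ a ∈ l'.1, a ∈ l.1 ∨ a ∈ L ∪ L') ∧ G l'.1 ⊆ L := by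
    rintro m ⟨l, hl⟩
    by_cases hm : m ∈ L' ∧ m ∉ l
    · obtain ⟨l', h₁, h₂, h₃, h₄, h₅⟩ := hext (l ++ [m]) (List.concat_eq_append ▸ hl.concat hm.2)
      refine ⟨⟨l', h₁⟩, (List.prefix_append _ _).trans h₂, ?_, fun _ => h₂.subset (by simp),
        fun a ha => ?_, h₅⟩
      · simp only [List.length_append, List.length_singleton] at h₃
        exact (Nat.lt_succ_self _).trans h₃
      · rcases h₄ a ha with h | h
        · rcases List.mem_append.1 h with h | h
          · exact Or.inl h
          · rw [List.mem_singleton.1 h]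
            exact Or.inr (Or.inr hm.1)
        · exact Or.inr (Or.inl h)
    · obtain ⟨l', h₁, h₂, h₃, h₄, h₅⟩ := hext l hl
      refine ⟨⟨l', h₁⟩, h₂, h₃, fun h => h₂.subset ?_, fun a ha => (h₄ a ha).imp_right Or.inl, h₅⟩
      by_contra h'
      exact hm ⟨h, h'⟩
  choose next hpre hlen hcover hsub hGnext using hstep
  let S : ℕ → {l : List ℕ // l.Nodup} := fun k => Nat.rec ⟨[], List.nodup_nil⟩ next k
  obtain ⟨x, hx, hxS, hrange⟩ := exists_limit_of_prefix_chain (S := fun k => (S k).1)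
    (fun k => (S k).2) (fun k => hpre k (S k)) (fun k => hlen k (S k))
  have hSsub : ∀ k, ∀ a ∈ (S k).1, a ∈ L ∪ L' := by
    intro k
    induction k with
    | zero => intro a ha; exact absurd ha List.not_mem_nil
    | succ k ih => exact fun a ha => (hsub k (S k) a ha).elim (ih a) id
  refine ⟨x, hx, ?_, ?_, ?_⟩
  · rw [hrange]
    rintro a ⟨k, hk⟩
    exact hSsub k a hk
  · intro a ha
    rw [hrange]
    exact ⟨a + 1, hcover a (S a) ha⟩
  · refine frequently_atTop.2 fun n => ⟨(S (n + 1)).1.length, ?_, ?_⟩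
    · exact (Nat.le_succ n).trans
        ((strictMono_nat_of_lt_succ fun k => hlen k (S k)).id_le (n + 1))
    · rw [hxS (n + 1)]
      exact hGnext n (S n)

/-- The rank of the language `𝓛 k` on the sample `S`: its index plus the number of elements
of `S` it misses. -/
noncomputable def languageCost (𝓛 : ℕ → Set ℕ) (S : Set ℕ) (k : ℕ) : ℕ :=
  k + (S \ 𝓛 k).ncard

/-- A language is critical on a sample if it is contained, modulo finite sets, in every language
of no larger cost. -/
def IsCritical (𝓛 : ℕ → Set ℕ) (S : Set ℕ) (i : ℕ) : Prop :=
  ∀ k, languageCost 𝓛 S k ≤ languageCost 𝓛 S i → (𝓛 i \ 𝓛 k).Finite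

lemma finite_setOf_languageCost_le (𝓛 : ℕ → Set ℕ) (S : Set ℕ) (c : ℕ) :
    {k | languageCost 𝓛 S k ≤ c}.Finite :=
  (Set.finite_Iic c).subset fun k hk => (Nat.le_add_right k _).trans hk

/-- A critical language of maximal cost at most `c`, intersected with all languages of no larger
cost, is contained in every critical language of cost at most `c`. -/
lemma exists_subset_of_isCritical (𝓛 : ℕ → Set ℕ) {S : Set ℕ} (hS : S.Finite) (c : ℕ) :
    ∃ A : Set ℕ, ∀ i, IsCritical 𝓛 S i → languageCost 𝓛 S i ≤ c →
      A ⊆ 𝓛 i \ S ∧ ∃ j, (𝓛 j \ 𝓛 i).Finite ∧ (𝓛 j \ A).Finite := by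
  let C : Set ℕ := {i | IsCritical 𝓛 S i ∧ languageCost 𝓛 S i ≤ c}
  rcases C.eq_empty_or_nonempty with hC | hC
  · exact ⟨∅, fun i hi hic => absurd (show i ∈ C from ⟨hi, hic⟩) (hC ▸ Set.notMem_empty i)⟩
  have hCfin : C.Finite := (finite_setOf_languageCost_le 𝓛 S c).subset fun i hi => hi.2
  obtain ⟨j, hj, hmax⟩ := Set.exists_max_image C (languageCost 𝓛 S) hCfin hC
  refine ⟨{a | ∀ k, languageCost 𝓛 S k ≤ languageCost 𝓛 S j → a ∈ 𝓛 k} \ S,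
    fun i hi hic => ⟨fun a ha => ⟨ha.1 i (hmax i ⟨hi, hic⟩), ha.2⟩, j,
      hj.1 i (hmax i ⟨hi, hic⟩), ?_⟩⟩
  refine (((finite_setOf_languageCost_le 𝓛 S (languageCost 𝓛 S j)).biUnion
    fun k hk => hj.1 k hk).union hS).subset fun a ha => ?_
  by_cases haS : a ∈ S
  · exact Or.inr haS
  · have h : ¬ ∀ k, languageCost 𝓛 S k ≤ languageCost 𝓛 S j → a ∈ 𝓛 k := fun h => ha.2 ⟨h, haS⟩
    push Not at h
    obtain ⟨k, hk, hak⟩ := h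
    exact Or.inl (Set.mem_biUnion hk ⟨ha.1, hak⟩)

/-- The target language is eventually critical, with bounded cost. -/
lemma eventually_isCritical (𝓛 : ℕ → Set ℕ) (i : ℕ) {x : ℕ → ℕ}
    (hnoise : (Set.range x \ 𝓛 i).Finite) (homit : (𝓛 i \ Set.range x).Finite) :
    ∀ᶠ n in atTop, IsCritical 𝓛 (seen x n) i ∧ languageCost 𝓛 (seen x n) i ≤ n := by
  set c := i + (Set.range x \ 𝓛 i).ncard
  have hcost : ∀ n, languageCost 𝓛 (seen x n) i ≤ c := fun n =>
    Nat.add_le_add_left (Set.ncard_le_ncard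
      (Set.sdiff_subset_sdiff_left (seen_subset_range x n)) hnoise) i
  have hlarge : ∀ k ∈ Set.Iic c, ∀ᶠ n in atTop,
      languageCost 𝓛 (seen x n) k ≤ c → (𝓛 i \ 𝓛 k).Finite := by
    intro k _
    by_cases hk : (Set.range x \ 𝓛 k).Finite
    · refine Eventually.of_forall fun n _ => (homit.union hk).subset fun a ha => ?_
      by_cases hax : a ∈ Set.range x
      · exact Or.inr ⟨hax, ha.2⟩
      · exact Or.inl ⟨ha.1, hax⟩
    · obtain ⟨T, hTsub, hTcard⟩ := Set.Infinite.exists_subset_card_eq hk (c + 1)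
      filter_upwards [eventually_subset_seen T.finite_toSet (hTsub.trans Set.sdiff_subset)]
        with n hn hle
      have h : (T : Set ℕ).ncard ≤ (seen x n \ 𝓛 k).ncard :=
        Set.ncard_le_ncard (fun a ha => ⟨hn ha, (hTsub ha).2⟩) (seen_finite x n).sdiff
      rw [Set.ncard_coe_finset] at h
      unfold languageCost at hle
      omega
  filter_upwards [(eventually_all_finite (Set.finite_Iic c)).2 hlarge, eventually_ge_atTop c]
    with n hn hcn
  exact ⟨fun k hk => hn k ((Nat.le_add_right k _).trans (hk.trans (hcost n)))
    (hk.trans (hcost n)), (hcost n).trans hcn⟩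

/-- Characterization of set-based lower density `ρ` generation under finite contamination. -/
theorem set_based_lower_density_finite_contamination_characterization
    (ρ : ℝ) (hρ : 0 < ρ) (𝓛 : ℕ → Set ℕ) (hinf : ∀ i, (𝓛 i).Infinite) :
    (∃ G : List ℕ → Set ℕ, ∀ i : ℕ, ∀ x : ℕ → ℕ,
      Function.Injective x →
      (Set.range x \ 𝓛 i).Finite → (𝓛 i \ Set.range x).Finite →
      (∃ nstar : ℕ, ∀ n ≥ nstar, G (prefixList x n) ⊆ 𝓛 i \ seen x n) ∧
      Filter.liminf (fun n => lowDensity (G (prefixList x n)) (𝓛 i)) Filter.atTop ≥ ρ)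
    ↔
    (∀ i j : ℕ, (𝓛 i \ 𝓛 j).Finite → lowDensity (𝓛 i) (𝓛 j) ≥ ρ) := by
  constructor
  · rintro ⟨G, hG⟩ i j hij
    obtain ⟨x, hx, hsub, hsup, hfreq⟩ := exists_enumeration_frequently_subset (G := G) (𝓛 j)
      (hinf i) fun x hx h₁ h₂ => by
        obtain ⟨⟨n₀, hn₀⟩, -⟩ := hG i x hx h₁ h₂
        exact eventually_atTop.2 ⟨n₀, fun n hn => (hn₀ n hn).trans Set.sdiff_subset⟩
    have hlim := (hG j x hx
      (hij.subset fun a ha => ⟨(hsub ha.1).resolve_right ha.2, ha.2⟩)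
      (by rw [Set.sdiff_eq_empty.2 hsup]; exact Set.finite_empty)).2
    by_contra! hlt
    have hev := eventually_lt_of_lt_liminf (hlt.trans_le hlim)
      (isBoundedUnder_of ⟨0, fun n => lowDensity_nonneg _ _⟩)
    obtain ⟨n, hGn, hn⟩ := (hfreq.and_eventually hev).exists
    refine hn.not_ge (lowDensity_le_of_diff_finite (hinf j) ?_)
    rw [Set.sdiff_eq_empty.2 hGn]
    exact Set.finite_empty
  · intro h
    choose G hG using fun l : List ℕ =>
      exists_subset_of_isCritical 𝓛 (S := {a | a ∈ l}) l.finite_toSet l.length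
    refine ⟨G, fun i x _ hnoise homit => ?_⟩
    have hev : ∀ᶠ n in atTop, G (prefixList x n) ⊆ 𝓛 i \ seen x n ∧
        ρ ≤ lowDensity (G (prefixList x n)) (𝓛 i) := by
      filter_upwards [eventually_isCritical 𝓛 i hnoise homit] with n hn
      have hseen : {a | a ∈ prefixList x n} = seen x n := Set.ext fun a => mem_prefixList
      have hGn := hG (prefixList x n) i
      rw [hseen, length_prefixList] at hGn
      obtain ⟨hsub, j, hji, hjG⟩ := hGn hn.1 hn.2
      exact ⟨hsub, (h j i hji).trans (lowDensity_le_of_diff_finite (hinf i) hjG)⟩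
    refine ⟨eventually_atTop.1 (hev.mono fun n hn => hn.1), ?_⟩
    exact le_liminf_of_le (isBoundedUnder_of ⟨1, fun n => lowDensity_le_one _ _⟩ :
      IsBoundedUnder (· ≤ ·) atTop _).isCoboundedUnder_ge (hev.mono fun n hn => hn.2)
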